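/- Let p_1, p_2, p_3 be three distinct points of K² not all lying on a common affine line, and let I = I(p_1) ∩ I(p_2) ∩ I(p_3). Then α(I^{m}) = 3m/2 for every even positive integer m, and lim_{m→∞} α(I^m)/m = 3/2. -/

import Mathlib

open MvPolynomial Filter
open scoped Classical

noncomputable section

/-- The (maximal) ideal of polynomials vanishing at the point `p` of affine `n`-space. -/
def pointIdeal {n : ℕ} (K : Type*) [Field K] (p : Fin n → K) :
    Ideal (MvPolynomial (Fin n) K) :=
  RingHom.ker (MvPolynomial.eval p)

/-- The homogeneous ideal generated by the forms vanishing at (a representative of) a point of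
projective space. -/
def projPointIdeal {N : ℕ} (K : Type*) [Field K] (p : Fin N → K) :
    Ideal (MvPolynomial (Fin N) K) :=
  Ideal.span { f | (∃ d, f.IsHomogeneous d) ∧ MvPolynomial.eval p f = 0 }

/-- `α(I)`: the least degree of a nonzero element of `I`. -/
def alphaDeg {σ K : Type*} [Field K] (I : Ideal (MvPolynomial σ K)) : ℕ :=
  sInf { d | ∃ f ∈ I, f ≠ 0 ∧ f.totalDegree = d }

/-- `H^≤_I(t) = dim_K I_{≤ t}`. -/
def hilbLe {n : ℕ} (K : Type*) [Field K] (I : Ideal (MvPolynomial (Fin n) K)) (t : ℕ) : ℕ :=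
  Module.finrank K
    ↥(Submodule.restrictScalars K I ⊓ MvPolynomial.restrictTotalDegree (Fin n) K t)

/-- `H_{R/I}(t) = dim_K R_t/I_t = dim_K R_t - dim_K I_t`. -/
def hilbProj {N : ℕ} (K : Type*) [Field K] (I : Ideal (MvPolynomial (Fin N) K)) (t : ℕ) : ℕ :=
  Module.finrank K ↥(MvPolynomial.homogeneousSubmodule (Fin N) K t) -
    Module.finrank K
      ↥(Submodule.restrictScalars K I ⊓ MvPolynomial.homogeneousSubmodule (Fin N) K t)

/-- The expansion of a polynomial around the point `p`. -/
def taylorAt {σ K : Type*} [Field K] (p : σ → K) : MvPolynomial σ K →ₐ[K] MvPolynomial σ K :=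
  aeval fun i => X i + C (p i)

/-- The order of vanishing of a polynomial at the point `p`. -/
def ordAt {σ K : Type*} [Field K] (p : σ → K) (f : MvPolynomial σ K) : ℕ∞ :=
  MvPowerSeries.order (taylorAt p f : MvPowerSeries σ K)

section ordAt

variable {σ K : Type*} [Field K]

lemma ordAt_mul (p : σ → K) (f g : MvPolynomial σ K) :
    ordAt p (f * g) = ordAt p f + ordAt p g := by
  simp [ordAt, MvPowerSeries.order_mul]

lemma constantCoeff_taylorAt (p : σ → K) (f : MvPolynomial σ K) :
    constantCoeff (taylorAt p f) = eval p f := by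
  have : (constantCoeff (σ := σ) (R := K)).comp (taylorAt p).toRingHom = eval p := by
    ext i <;> simp [taylorAt]
  exact congrArg (fun φ : MvPolynomial σ K →+* K => φ f) this

lemma one_le_ordAt_iff {p : σ → K} {f : MvPolynomial σ K} : 1 ≤ ordAt p f ↔ eval p f = 0 := by
  rw [ordAt, MvPowerSeries.one_le_order_iff_constCoeff_eq_zero, ← constantCoeff_taylorAt,
    ← MvPowerSeries.coeff_zero_eq_constantCoeff_apply, coeff_coe, constantCoeff_eq]

lemma le_ordAt_add {p : σ → K} {f g : MvPolynomial σ K} {a : ℕ∞}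
    (hf : a ≤ ordAt p f) (hg : a ≤ ordAt p g) : a ≤ ordAt p (f + g) := by
  have h := MvPowerSeries.min_order_le_add
    (f := (taylorAt p f : MvPowerSeries σ K)) (g := (taylorAt p g : MvPowerSeries σ K))
  rw [← coe_add, ← map_add] at h
  exact (le_min hf hg).trans h

lemma le_ordAt_of_mem_pow {n : ℕ} {p : Fin n → K} {I : Ideal (MvPolynomial (Fin n) K)}
    (hI : I ≤ pointIdeal K p) (m : ℕ) :
    ∀ f ∈ I ^ m, (m : ℕ∞) ≤ ordAt p f := by
  induction m with
  | zero => simp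
  | succ m ih =>
    intro f hf
    rw [pow_succ] at hf
    refine Submodule.mul_induction_on hf (fun g hg h hh => ?_)
      (fun g h hg hh => le_ordAt_add hg hh)
    rw [ordAt_mul, Nat.cast_add, Nat.cast_one]
    exact add_le_add (ih g hg) (one_le_ordAt_iff.2 (hI hh))

lemma pow_dvd_aeval_of_le_ordAt {p : σ → K} {f : MvPolynomial σ K} {a : ℕ}
    (hf : (a : ℕ∞) ≤ ordAt p f) (s : Polynomial K) (w : σ → K) :
    s ^ a ∣ aeval (fun i => Polynomial.C (p i) + s * Polynomial.C (w i)) f := by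
  have h : (aeval fun i => s * Polynomial.C (w i)).comp (taylorAt p) =
      aeval (fun i => Polynomial.C (p i) + s * Polynomial.C (w i)) := by
    ext1 i
    simp [taylorAt, add_comm, Polynomial.algebraMap_eq]
  rw [← h, AlgHom.comp_apply, aeval_def, eval₂_eq]
  refine Finset.dvd_sum fun d hd => Dvd.dvd.mul_left ?_ _
  have had : a ≤ d.degree := by
    by_contra! hlt
    refine mem_support_iff.1 hd ?_
    rw [← coeff_coe]
    exact MvPowerSeries.coeff_of_lt_order (lt_of_lt_of_le (by exact_mod_cast hlt) hf)
  simp_rw [mul_pow]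
  rw [Finset.prod_mul_distrib, Finset.prod_pow_eq_pow_sum, ← Finsupp.degree_apply]
  exact (pow_dvd_pow s had).mul_right _

end ordAt

section linePoly

variable {K : Type*} [Field K]

/-- An equation of the line through the points `p` and `q`. -/
def linePoly (p q : Fin 2 → K) : MvPolynomial (Fin 2) K :=
  C (q 0 - p 0) * (X 1 - C (p 1)) - C (q 1 - p 1) * (X 0 - C (p 0))

/-- Twice the signed area of the triangle with vertices `p`, `q`, `r`. -/
def triangleDet (p q r : Fin 2 → K) : K :=
  (q 0 - p 0) * (r 1 - p 1) - (q 1 - p 1) * (r 0 - p 0)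

lemma triangleDet_rotate (p q r : Fin 2 → K) : triangleDet q r p = triangleDet p q r := by
  simp only [triangleDet]; ring

lemma eval_linePoly (p q r : Fin 2 → K) : eval r (linePoly p q) = triangleDet p q r := by
  simp [linePoly, triangleDet]

lemma linePoly_add_linePoly_add_linePoly (p q r : Fin 2 → K) :
    linePoly p q + linePoly q r + linePoly r p = C (triangleDet p q r) := by
  simp only [linePoly, triangleDet, map_sub, map_mul]; ring

lemma totalDegree_linePoly_le (p q : Fin 2 → K) : (linePoly p q).totalDegree ≤ 1 := by
  have h : ∀ (a b : K) (i : Fin 2), (C a * (X i - C b)).totalDegree ≤ 1 := fun a b i => by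
    refine (totalDegree_mul _ _).trans ?_
    simpa using (totalDegree_sub_C_le (X i : MvPolynomial (Fin 2) K) b)
  exact (totalDegree_sub _ _).trans (max_le (h _ _ _) (h _ _ _))

lemma coeff_single_taylorAt_linePoly (p q r : Fin 2 → K) :
    coeff (Finsupp.single 1 1) (taylorAt r (linePoly p q)) = q 0 - p 0 ∧
    coeff (Finsupp.single 0 1) (taylorAt r (linePoly p q)) = -(q 1 - p 1) := by
  have h10 : (Finsupp.single (1 : Fin 2) 1 : Fin 2 →₀ ℕ) ≠ 0 := by simp
  have h00 : (Finsupp.single (0 : Fin 2) 1 : Fin 2 →₀ ℕ) ≠ 0 := by simp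
  simp only [taylorAt, linePoly, map_sub, map_mul, aeval_X, algHom_C, algebraMap_eq]
  simp only [← map_sub, add_sub_assoc, coeff_sub, coeff_C_mul, coeff_add, coeff_X, coeff_C]
  simp [Finsupp.single_left_inj, h10.symm, h00.symm]

lemma ordAt_linePoly_le_one {p q : Fin 2 → K} (hpq : p ≠ q) (r : Fin 2 → K) :
    ordAt r (linePoly p q) ≤ 1 := by
  obtain ⟨h1, h0⟩ := coeff_single_taylorAt_linePoly p q r
  have key : ∀ i : Fin 2, coeff (Finsupp.single i 1) (taylorAt r (linePoly p q)) ≠ 0 →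
      ordAt r (linePoly p q) ≤ 1 := fun i hi => by
    rw [← coeff_coe] at hi
    simpa [ordAt] using MvPowerSeries.order_le hi
  by_cases h : q 0 - p 0 = 0
  · refine key 0 fun h' => hpq ?_
    rw [h0] at h'
    ext i
    fin_cases i
    · exact (sub_eq_zero.1 h).symm
    · exact (sub_eq_zero.1 (neg_eq_zero.1 h')).symm
  · exact key 1 (h1 ▸ h)

lemma linePoly_dvd_of_aeval_eq_zero {p q : Fin 2 → K} (hpq : p ≠ q) {f : MvPolynomial (Fin 2) K}
    (hf : aeval (fun i => Polynomial.C (p i) + Polynomial.X * Polynomial.C (q i - p i)) f = 0) :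
    linePoly p q ∣ f := by
  obtain ⟨u, hu⟩ : ∃ u : Fin 2 → K, u 0 * (q 0 - p 0) + u 1 * (q 1 - p 1) = 1 := by
    by_cases h : q 0 - p 0 = 0
    · have h' : q 1 - p 1 ≠ 0 := fun h' => hpq <| by
        ext i
        fin_cases i
        · exact (sub_eq_zero.1 h).symm
        · exact (sub_eq_zero.1 h').symm
      exact ⟨![0, (q 1 - p 1)⁻¹], by simp [h']⟩
    · exact ⟨![(q 0 - p 0)⁻¹, 0], by simp [h]⟩
  set π := Ideal.Quotient.mkₐ K (Ideal.span {linePoly p q}) with hπ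
  set t : MvPolynomial (Fin 2) K := C (u 0) * (X 0 - C (p 0)) + C (u 1) * (X 1 - C (p 1)) with ht
  have hC : C (u 0) * (C (q 0) - C (p 0)) + C (u 1) * (C (q 1) - C (p 1)) =
      (1 : MvPolynomial (Fin 2) K) := by
    simpa using congrArg (C (σ := Fin 2)) hu
  have hcomp : (π.comp (Polynomial.aeval t)).comp
      (aeval fun i => Polynomial.C (p i) + Polynomial.X * Polynomial.C (q i - p i)) = π := by
    ext1 i
    simp only [AlgHom.comp_apply, aeval_X, map_add, map_mul, Polynomial.aeval_C,
      Polynomial.aeval_X]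
    simp only [← map_add, ← map_mul, algebraMap_eq]
    rw [hπ, Ideal.Quotient.mkₐ_eq_mk, Ideal.Quotient.mk_eq_mk_iff_sub_mem,
      Ideal.mem_span_singleton]
    fin_cases i
    · refine ⟨C (u 1), ?_⟩
      simp only [ht, linePoly, map_sub, Fin.zero_eta]
      linear_combination (X 0 - C (p 0)) * hC
    · refine ⟨-C (u 0), ?_⟩
      simp only [ht, linePoly, map_sub, Fin.mk_one]
      linear_combination (X 1 - C (p 1)) * hC
  have h := congrArg (fun φ => φ f) hcomp
  simp only [AlgHom.comp_apply, hf, map_zero] at h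
  rw [hπ, Ideal.Quotient.mkₐ_eq_mk] at h
  exact Ideal.mem_span_singleton.1 (Ideal.Quotient.eq_zero_iff_mem.1 h.symm)

/-- A polynomial of degree less than the intersection number forced at `p` and `q` contains the
line through `p` and `q`. -/
lemma linePoly_dvd_of_totalDegree_lt {p q : Fin 2 → K} (hpq : p ≠ q) {f : MvPolynomial (Fin 2) K}
    {a b : ℕ} (ha : (a : ℕ∞) ≤ ordAt p f) (hb : (b : ℕ∞) ≤ ordAt q f)
    (hd : f.totalDegree < a + b) : linePoly p q ∣ f := by
  refine linePoly_dvd_of_aeval_eq_zero hpq ?_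
  have h0 := pow_dvd_aeval_of_le_ordAt ha Polynomial.X (fun i => q i - p i)
  have h1 := pow_dvd_aeval_of_le_ordAt hb (Polynomial.X - Polynomial.C 1) (fun i => q i - p i)
  have heq : (fun i => Polynomial.C (q i) +
      (Polynomial.X - Polynomial.C 1) * Polynomial.C (q i - p i)) =
      fun i => Polynomial.C (p i) + Polynomial.X * Polynomial.C (q i - p i) := by
    ext1 i
    simp only [map_sub, map_one]; ring
  rw [heq] at h1
  have hcop : IsCoprime (Polynomial.X ^ a : Polynomial K)
      ((Polynomial.X - Polynomial.C 1) ^ b) :=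
    IsCoprime.pow ⟨1, -1, by simp⟩
  refine Polynomial.eq_zero_of_dvd_of_natDegree_lt (hcop.mul_dvd h0 h1) ?_
  have hdeg := aeval_natDegree_le (n := 1) f le_rfl
    (fun i => Polynomial.C (p i) + Polynomial.X * Polynomial.C (q i - p i)) fun i => by
      compute_degree
  rw [(Polynomial.monic_X_pow a).natDegree_mul ((Polynomial.monic_X_sub_C 1).pow b),
    Polynomial.natDegree_X_pow, Polynomial.natDegree_pow, Polynomial.natDegree_X_sub_C]
  omega

/-- Splitting off the line through two of the three points. -/
lemma exists_quotient_of_totalDegree_lt {p q r : Fin 2 → K} (hD : triangleDet p q r ≠ 0)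
    {f : MvPolynomial (Fin 2) K} (hf : f ≠ 0) {a b c : ℕ} (ha : (a : ℕ∞) ≤ ordAt p f)
    (hb : (b : ℕ∞) ≤ ordAt q f) (hc : (c : ℕ∞) ≤ ordAt r f) (hd : f.totalDegree < a + b) :
    ∃ g : MvPolynomial (Fin 2) K, g ≠ 0 ∧ f.totalDegree = g.totalDegree + 1 ∧
      ((a - 1 : ℕ) : ℕ∞) ≤ ordAt p g ∧ ((b - 1 : ℕ) : ℕ∞) ≤ ordAt q g ∧
      (c : ℕ∞) ≤ ordAt r g := by
  have hpq : p ≠ q := by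
    rintro rfl
    simp [triangleDet] at hD
  obtain ⟨g, rfl⟩ := linePoly_dvd_of_totalDegree_lt hpq ha hb hd
  have hl := left_ne_zero_of_mul hf
  have hg := right_ne_zero_of_mul hf
  have hle := totalDegree_linePoly_le p q
  have hne : (linePoly p q).totalDegree ≠ 0 := fun h => by
    have hcst := totalDegree_eq_zero_iff_eq_C.1 h
    have hev := eval_linePoly p q p
    rw [hcst, eval_C] at hev
    rw [hev] at hcst
    refine hl (hcst.trans ?_)
    simp [triangleDet]
  rw [ordAt_mul] at ha hb hc
  have hstep : ∀ (s : Fin 2 → K) (n : ℕ), (n : ℕ∞) ≤ ordAt s (linePoly p q) + ordAt s g →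
      ((n - 1 : ℕ) : ℕ∞) ≤ ordAt s g := fun s n h => by
    rw [ENat.natCast_sub, Nat.cast_one, tsub_le_iff_left]
    exact h.trans (add_le_add_left (ordAt_linePoly_le_one hpq s) _)
  refine ⟨g, hg, ?_, hstep _ _ ha, hstep _ _ hb, ?_⟩
  · rw [totalDegree_mul_of_isDomain hl hg]
    omega
  · have h0 : ordAt r (linePoly p q) = 0 := by
      rw [← Order.lt_one_iff, ← not_le, one_le_ordAt_iff, eval_linePoly]
      exact hD
    rwa [h0, zero_add] at hc

lemma add_add_le_two_mul_totalDegree {p q r : Fin 2 → K} (hD : triangleDet p q r ≠ 0) (d : ℕ) :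
    ∀ (f : MvPolynomial (Fin 2) K) (a b c : ℕ), f ≠ 0 → f.totalDegree = d →
      (a : ℕ∞) ≤ ordAt p f → (b : ℕ∞) ≤ ordAt q f → (c : ℕ∞) ≤ ordAt r f →
      a + b + c ≤ 2 * d := by
  induction d with
  | zero =>
    intro f a b c hf hd ha hb hc
    have hD' : triangleDet q r p ≠ 0 := by rwa [triangleDet_rotate]
    by_contra! hlt
    rcases Nat.eq_zero_or_pos (a + b) with h | h
    · obtain ⟨g, -, hg, -⟩ := exists_quotient_of_totalDegree_lt hD' hf hb hc ha (by omega)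
      omega
    · obtain ⟨g, -, hg, -⟩ := exists_quotient_of_totalDegree_lt hD hf ha hb hc (by omega)
      omega
  | succ d ih =>
    intro f a b c hf hd ha hb hc
    have hD' : triangleDet q r p ≠ 0 := by rwa [triangleDet_rotate]
    have hD'' : triangleDet r p q ≠ 0 := by rwa [triangleDet_rotate]
    by_cases h1 : f.totalDegree < a + b
    · obtain ⟨g, hg, hdg, ha, hb, hc⟩ := exists_quotient_of_totalDegree_lt hD hf ha hb hc h1
      have := ih g _ _ _ hg (by omega) ha hb hc
      omega
    by_cases h2 : f.totalDegree < b + c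
    · obtain ⟨g, hg, hdg, hb, hc, ha⟩ := exists_quotient_of_totalDegree_lt hD' hf hb hc ha h2
      have := ih g _ _ _ hg (by omega) ha hb hc
      omega
    by_cases h3 : f.totalDegree < c + a
    · obtain ⟨g, hg, hdg, hc, ha, hb⟩ := exists_quotient_of_totalDegree_lt hD'' hf hc ha hb h3
      have := ih g _ _ _ hg (by omega) ha hb hc
      omega
    omega

lemma linePoly_ne_zero {p q r : Fin 2 → K} (hD : triangleDet p q r ≠ 0) : linePoly p q ≠ 0 :=
  fun h => hD <| by rw [← eval_linePoly, h, map_zero]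

/-- The product of the three sides of a triangle lies in the square of the ideal of its
vertices. -/
lemma linePoly_mul_linePoly_mul_linePoly_mem_sq {p q r : Fin 2 → K} (hD : triangleDet p q r ≠ 0)
    {I : Ideal (MvPolynomial (Fin 2) K)}
    (hI : ∀ f, eval p f = 0 → eval q f = 0 → eval r f = 0 → f ∈ I) :
    linePoly p q * linePoly q r * linePoly r p ∈ I ^ 2 := by
  set l := linePoly p q with hl
  set m := linePoly q r with hm
  set n := linePoly r p with hn
  have hlm : l * m ∈ I := by
    apply hI <;> simp [hl, hm, eval_linePoly, triangleDet, mul_comm]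
  have hmn : m * n ∈ I := by
    apply hI <;> simp [hm, hn, eval_linePoly, triangleDet, mul_comm]
  have hnl : n * l ∈ I := by
    apply hI <;> simp [hn, hl, eval_linePoly, triangleDet, mul_comm]
  have hinv : C (triangleDet p q r)⁻¹ * (l + m + n) = 1 := by
    rw [hl, hm, hn, linePoly_add_linePoly_add_linePoly, ← C_mul, inv_mul_cancel₀ hD, C_1]
  have : l * m * n =
      C (triangleDet p q r)⁻¹ * ((n * l) * (l * m) + (l * m) * (m * n) + (m * n) * (n * l)) := by
    linear_combination -(l * m * n) * hinv
  rw [this, sq]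
  exact Ideal.mul_mem_left _ _ (add_mem (add_mem (Ideal.mul_mem_mul hnl hlm)
    (Ideal.mul_mem_mul hlm hmn)) (Ideal.mul_mem_mul hmn hnl))

lemma exists_mem_pow_two_mul {p q r : Fin 2 → K} (hD : triangleDet p q r ≠ 0)
    {I : Ideal (MvPolynomial (Fin 2) K)}
    (hI : ∀ f, eval p f = 0 → eval q f = 0 → eval r f = 0 → f ∈ I) (k : ℕ) :
    ∃ f ∈ I ^ (2 * k), f ≠ 0 ∧ f.totalDegree ≤ 3 * k := by
  have hD' : triangleDet q r p ≠ 0 := by rwa [triangleDet_rotate]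
  have hD'' : triangleDet r p q ≠ 0 := by rwa [triangleDet_rotate]
  refine ⟨(linePoly p q * linePoly q r * linePoly r p) ^ k, ?_, ?_, ?_⟩
  · rw [pow_mul]
    exact Ideal.pow_mem_pow (linePoly_mul_linePoly_mul_linePoly_mem_sq hD hI) k
  · exact pow_ne_zero _ (mul_ne_zero (mul_ne_zero (linePoly_ne_zero hD) (linePoly_ne_zero hD'))
      (linePoly_ne_zero hD''))
  · refine (totalDegree_pow _ _).trans ?_
    rw [mul_comm]
    refine Nat.mul_le_mul_right k ?_
    have h1 := totalDegree_mul (linePoly p q * linePoly q r) (linePoly r p)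
    have h2 := totalDegree_mul (linePoly p q) (linePoly q r)
    have h3 := totalDegree_linePoly_le p q
    have h4 := totalDegree_linePoly_le q r
    have h5 := totalDegree_linePoly_le r p
    omega

lemma triangleDet_ne_zero_of_not_collinear {p : Fin 3 → (Fin 2 → K)} (h01 : p 0 ≠ p 1)
    (hnc : ¬ ∃ v w : Fin 2 → K, w ≠ 0 ∧ ∀ i, ∃ c : K, p i = v + c • w) :
    triangleDet (p 0) (p 1) (p 2) ≠ 0 := by
  intro hD
  rw [triangleDet] at hD
  refine hnc ⟨p 0, p 1 - p 0, sub_ne_zero.2 h01.symm, fun i => ?_⟩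
  fin_cases i
  · exact ⟨0, by simp⟩
  · exact ⟨1, by simp⟩
  · by_cases h : p 1 0 - p 0 0 = 0
    · have h' : p 1 1 - p 0 1 ≠ 0 := fun h' => h01 <| by
        ext i
        fin_cases i
        · exact (sub_eq_zero.1 h).symm
        · exact (sub_eq_zero.1 h').symm
      refine ⟨(p 2 1 - p 0 1) / (p 1 1 - p 0 1), ?_⟩
      ext i
      fin_cases i
      · simp only [Fin.reduceFinMk, Fin.zero_eta, Pi.add_apply, Pi.smul_apply, Pi.sub_apply,
          smul_eq_mul]
        field_simp
        linear_combination -hD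
      · simp only [Fin.reduceFinMk, Fin.mk_one, Pi.add_apply, Pi.smul_apply, Pi.sub_apply,
          smul_eq_mul]
        field_simp
        ring
    · refine ⟨(p 2 0 - p 0 0) / (p 1 0 - p 0 0), ?_⟩
      ext i
      fin_cases i
      · simp only [Fin.reduceFinMk, Fin.zero_eta, Pi.add_apply, Pi.smul_apply, Pi.sub_apply,
          smul_eq_mul]
        field_simp
        ring
      · simp only [Fin.reduceFinMk, Fin.mk_one, Pi.add_apply, Pi.smul_apply, Pi.sub_apply,
          smul_eq_mul]
        field_simp
        linear_combination hD

end linePoly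

lemma alphaDeg_le {σ K : Type*} [Field K] {I : Ideal (MvPolynomial σ K)} {f : MvPolynomial σ K}
    (hf : f ∈ I) (h0 : f ≠ 0) : alphaDeg I ≤ f.totalDegree :=
  Nat.sInf_le ⟨f, hf, h0, rfl⟩

lemma exists_totalDegree_eq_alphaDeg {σ K : Type*} [Field K] {I : Ideal (MvPolynomial σ K)}
    {f : MvPolynomial σ K} (hf : f ∈ I) (h0 : f ≠ 0) :
    ∃ g ∈ I, g ≠ 0 ∧ g.totalDegree = alphaDeg I :=
  Nat.sInf_mem (s := { d | ∃ f ∈ I, f ≠ 0 ∧ f.totalDegree = d }) ⟨_, f, hf, h0, rfl⟩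

lemma tendsto_div_of_three_mul_le {u : ℕ → ℕ} (hlow : ∀ m, 3 * m ≤ 2 * u m)
    (hup : ∀ m, 2 * u m ≤ 3 * m + 3) :
    Tendsto (fun m : ℕ => (u m : ℝ) / m) atTop (nhds (3 / 2)) := by
  have hlim : Tendsto (fun m : ℕ => (3 / 2 : ℝ) + (3 / 2) / m) atTop (nhds (3 / 2)) := by
    simpa using (tendsto_const_div_atTop_nhds_zero_nat (3 / 2 : ℝ)).const_add (3 / 2 : ℝ)
  refine tendsto_of_tendsto_of_tendsto_of_le_of_le' tendsto_const_nhds hlim ?_ ?_ <;>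
    filter_upwards [eventually_gt_atTop 0] with m hm <;>
    have hm' : (0 : ℝ) < m := by exact_mod_cast hm
  · have h : (3 * m : ℝ) ≤ 2 * u m := by exact_mod_cast hlow m
    rw [le_div_iff₀ hm']
    linarith
  · have h : (2 * u m : ℝ) ≤ 3 * m + 3 := by exact_mod_cast hup m
    rw [div_le_iff₀ hm', add_mul, div_mul_cancel₀ _ hm'.ne']
    linarith

/-- for three distinct noncolinear points of `K²` with radical ideal `I`,
`α(I^m) = 3m/2` for every even positive `m`, and `lim α(I^m)/m = 3/2`. -/
theorem stmt_18 {K : Type*} [Field K] [IsAlgClosed K]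
    (p : Fin 3 → (Fin 2 → K)) (hp : Function.Injective p)
    (hnc : ¬ ∃ v w : Fin 2 → K, w ≠ 0 ∧ ∀ i, ∃ c : K, p i = v + c • w)
    (I : Ideal (MvPolynomial (Fin 2) K)) (hI : I = ⨅ i, pointIdeal K (p i)) :
    (∀ m : ℕ, 0 < m → Even m → 2 * alphaDeg (I ^ m) = 3 * m) ∧
    Filter.Tendsto (fun m : ℕ => (alphaDeg (I ^ m) : ℝ) / m) Filter.atTop
      (nhds (3 / 2)) := by
  have hmem : ∀ f, f ∈ I ↔ ∀ i, eval (p i) f = 0 := fun f => by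
    simp [hI, Submodule.mem_iInf, pointIdeal, RingHom.mem_ker]
  have hle : ∀ i, I ≤ pointIdeal K (p i) := fun i => hI ▸ iInf_le _ i
  have hD := triangleDet_ne_zero_of_not_collinear (hp.ne (by decide)) hnc
  have hex := exists_mem_pow_two_mul hD (I := I) fun f h0 h1 h2 =>
    (hmem f).2 (by simpa [Fin.forall_fin_succ] using ⟨h0, h1, h2⟩)
  have hlow : ∀ m, 3 * m ≤ 2 * alphaDeg (I ^ m) := fun m => by
    obtain ⟨f, hf, hf0, -⟩ := hex m
    obtain ⟨g, hg, hg0, hgd⟩ := exists_totalDegree_eq_alphaDeg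
      (Ideal.pow_le_pow_right (by omega : m ≤ 2 * m) hf) hf0
    have h := add_add_le_two_mul_totalDegree hD _ g m m m hg0 hgd
      (le_ordAt_of_mem_pow (hle 0) m g hg) (le_ordAt_of_mem_pow (hle 1) m g hg)
      (le_ordAt_of_mem_pow (hle 2) m g hg)
    omega
  have hup : ∀ m k, m ≤ 2 * k → alphaDeg (I ^ m) ≤ 3 * k := fun m k hmk => by
    obtain ⟨f, hf, hf0, hfd⟩ := hex k
    exact (alphaDeg_le (Ideal.pow_le_pow_right hmk hf) hf0).trans hfd
  refine ⟨fun m _ hm => ?_, tendsto_div_of_three_mul_le hlow fun m => ?_⟩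
  · obtain ⟨k, rfl⟩ := hm
    have h1 := hlow (k + k)
    have h2 := hup (k + k) k (by omega)
    omega
  · have h := hup m ((m + 1) / 2) (by omega)
    omega
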